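/- Let ν be a set function on the bounded Borel sets of ℝ which restricts to a finite signed measure on B([−N,N]) for every N ∈ ℕ, and suppose ν({x}) < 1/2 for all x ∈ ℝ. Then there exists a unique càdlàg function g_ν : ℝ → ℝ satisfying g_ν(x) = 1 − 2∫_{[0,x]} g_ν(y−) ν(dy) for x ≥ 0 and g_ν(x) = 1 + 2∫_{(x,0)} g_ν(y−) ν(dy) for x < 0. Moreover, g_ν is strictly positive and of locally bounded variation, and 1/g_ν is also of locally bounded variation. -/

import Mathlib

open MeasureTheory Filter

/-- `g` is a càdlàg solution of the integral equation
`g(x) = 1 - 2∫_{[0,x]} g(y-) ν(dy)` for `x ≥ 0` and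
`g(x) = 1 + 2∫_{(x,0)} g(y-) ν(dy)` for `x < 0`, where the locally finite
signed measure `ν` is represented as `νp - νm`. -/
def IsCadlagSolution (νp νm : Measure ℝ) (g : ℝ → ℝ) : Prop :=
  (∀ x, ContinuousWithinAt g (Set.Ici x) x) ∧
  (∀ x, Tendsto g (nhdsWithin x (Set.Iio x)) (nhds (Function.leftLim g x))) ∧
  (∀ x : ℝ, 0 ≤ x → g x = 1 - 2 *
    ((∫ y in Set.Icc 0 x, Function.leftLim g y ∂νp) -
      (∫ y in Set.Icc 0 x, Function.leftLim g y ∂νm))) ∧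
  (∀ x : ℝ, x < 0 → g x = 1 + 2 *
    ((∫ y in Set.Ioo x 0, Function.leftLim g y ∂νp) -
      (∫ y in Set.Ioo x 0, Function.leftLim g y ∂νm)))


section

open Set Topology

/-- The integral of `h` over `s` against the difference `νp - νm`. -/
noncomputable def diffSetIntegral (νp νm : Measure ℝ) (h : ℝ → ℝ) (s : Set ℝ) : ℝ :=
  (∫ y in s, h y ∂νp) - ∫ y in s, h y ∂νm

section DiffSetIntegral

variable {νp νm : Measure ℝ} {h h₁ h₂ : ℝ → ℝ} {s t : Set ℝ}

lemma diffSetIntegral_union (hst : Disjoint s t) (ht : MeasurableSet t)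
    (hs' : IntegrableOn h s (νp + νm)) (ht' : IntegrableOn h t (νp + νm)) :
    diffSetIntegral νp νm h (s ∪ t) = diffSetIntegral νp νm h s + diffSetIntegral νp νm h t := by
  rw [integrableOn_add_measure] at hs' ht'
  simp only [diffSetIntegral]
  rw [setIntegral_union hst ht hs'.1 ht'.1, setIntegral_union hst ht hs'.2 ht'.2]
  ring

lemma diffSetIntegral_singleton (x : ℝ) :
    diffSetIntegral νp νm h {x} = h x * ((νp {x}).toReal - (νm {x}).toReal) := by
  simp only [diffSetIntegral, integral_singleton, Measure.real, smul_eq_mul]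
  ring

lemma diffSetIntegral_sub (h₁s : IntegrableOn h₁ s (νp + νm)) (h₂s : IntegrableOn h₂ s (νp + νm)) :
    diffSetIntegral νp νm (fun y => h₁ y - h₂ y) s =
      diffSetIntegral νp νm h₁ s - diffSetIntegral νp νm h₂ s := by
  rw [integrableOn_add_measure] at h₁s h₂s
  simp only [diffSetIntegral]
  rw [integral_sub h₁s.1 h₂s.1, integral_sub h₁s.2 h₂s.2]
  ring

lemma abs_diffSetIntegral_le (hs : IntegrableOn h s (νp + νm)) :
    |diffSetIntegral νp νm h s| ≤ ∫ y in s, |h y| ∂(νp + νm) := by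
  have hs' := hs
  rw [integrableOn_add_measure] at hs
  rw [Measure.restrict_add, integral_add_measure hs.1.abs hs.2.abs]
  refine (abs_sub _ _).trans (add_le_add ?_ ?_) <;> exact abs_integral_le_integral_abs

lemma tendsto_setIntegral_zero_of_eventually_notMem {μ : Measure ℝ} {l : Filter ℝ}
    [l.IsCountablyGenerated] {s : ℝ → Set ℝ} {K : Set ℝ} (hs : ∀ t, MeasurableSet (s t))
    (hK : MeasurableSet K) (hsK : ∀ᶠ t in l, s t ⊆ K) (hh : IntegrableOn h K μ)
    (hz : ∀ z, ∀ᶠ t in l, z ∉ s t) :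
    Tendsto (fun t => ∫ y in s t, h y ∂μ) l (𝓝 0) := by
  have key : Tendsto (fun t => ∫ y, (s t).indicator (K.indicator h) y ∂μ) l
      (𝓝 (∫ _, (0 : ℝ) ∂μ)) := by
    have hi := (integrable_indicator_iff hK).2 hh
    refine tendsto_integral_filter_of_dominated_convergence (fun y => ‖K.indicator h y‖)
      (Eventually.of_forall fun t => hi.aestronglyMeasurable.indicator (hs t))
      (Eventually.of_forall fun t => Eventually.of_forall fun y => ?_) hi.norm
      (Eventually.of_forall fun z => ?_)
    · exact norm_indicator_le_norm_self _ _
    · refine tendsto_const_nhds.congr' ?_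
      filter_upwards [hz z] with t ht
      rw [indicator_of_notMem ht]
  rw [integral_zero] at key
  refine key.congr' ?_
  filter_upwards [hsK] with t ht
  rw [indicator_indicator, inter_eq_left.2 ht, integral_indicator (hs t)]

lemma tendsto_diffSetIntegral_zero {l : Filter ℝ}
    [l.IsCountablyGenerated] {s : ℝ → Set ℝ} {K : Set ℝ} (hs : ∀ t, MeasurableSet (s t))
    (hK : MeasurableSet K) (hsK : ∀ᶠ t in l, s t ⊆ K) (hh : IntegrableOn h K (νp + νm))
    (hz : ∀ z, ∀ᶠ t in l, z ∉ s t) :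
    Tendsto (fun t => diffSetIntegral νp νm h (s t)) l (𝓝 0) := by
  rw [integrableOn_add_measure] at hh
  simpa [diffSetIntegral] using (tendsto_setIntegral_zero_of_eventually_notMem hs hK hsK hh.1 hz).sub
    (tendsto_setIntegral_zero_of_eventually_notMem hs hK hsK hh.2 hz)

end DiffSetIntegral

lemma eventually_Ioc_subset_Icc (x : ℝ) : ∀ᶠ t in 𝓝[≥] x, Ioc x t ⊆ Icc x (x + 1) := by
  filter_upwards [nhdsWithin_le_nhds (Iio_mem_nhds (lt_add_one x))] with t ht
  exact Ioc_subset_Icc_self.trans (Icc_subset_Icc_right (le_of_lt ht))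

lemma eventually_notMem_Ioc (x z : ℝ) : ∀ᶠ t in 𝓝[≥] x, z ∉ Ioc x t := by
  rcases le_or_gt z x with hz | hz
  · exact Eventually.of_forall fun t ht => not_lt.2 hz ht.1
  · filter_upwards [nhdsWithin_le_nhds (Iio_mem_nhds hz)] with t ht hzt
    exact not_lt.2 hzt.2 ht

lemma eventually_Ioo_subset_Icc (x : ℝ) : ∀ᶠ t in 𝓝[<] x, Ioo t x ⊆ Icc (x - 1) x := by
  filter_upwards [nhdsWithin_le_nhds (Ioi_mem_nhds (sub_one_lt x))] with t ht
  exact Ioo_subset_Icc_self.trans (Icc_subset_Icc_left (le_of_lt ht))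

lemma eventually_notMem_Ioo (x z : ℝ) : ∀ᶠ t in 𝓝[<] x, z ∉ Ioo t x := by
  rcases le_or_gt x z with hz | hz
  · exact Eventually.of_forall fun t ht => not_lt.2 hz ht.2
  · filter_upwards [nhdsWithin_le_nhds (Ioi_mem_nhds hz)] with t ht hzt
    exact not_lt.2 hzt.1.le ht

/-- `g` and `h` satisfy the incremental form of the integral equation, where `h` plays the role of
the left limit of `g`. -/
structure IsIncrementSolution (νp νm : Measure ℝ) (g h : ℝ → ℝ) : Prop where
  integrableOn : ∀ a b, IntegrableOn h (Icc a b) (νp + νm)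
  increment : ∀ x y, x ≤ y → g y - g x = -2 * diffSetIntegral νp νm h (Ioc x y)
  jump : ∀ x, g x = h x * (1 - 2 * ((νp {x}).toReal - (νm {x}).toReal))

namespace IsIncrementSolution

variable {νp νm : Measure ℝ} {g h g₁ h₁ g₂ h₂ : ℝ → ℝ}

lemma sub (S₁ : IsIncrementSolution νp νm g₁ h₁) (S₂ : IsIncrementSolution νp νm g₂ h₂) :
    IsIncrementSolution νp νm (fun x => g₁ x - g₂ x) (fun x => h₁ x - h₂ x) where
  integrableOn a b := (S₁.integrableOn a b).sub (S₂.integrableOn a b)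
  increment x y hxy := by
    rw [diffSetIntegral_sub ((S₁.integrableOn x y).mono_set Ioc_subset_Icc_self)
      ((S₂.integrableOn x y).mono_set Ioc_subset_Icc_self)]
    linarith [S₁.increment x y hxy, S₂.increment x y hxy]
  jump x := by rw [S₁.jump x, S₂.jump x]; ring

lemma left_increment (S : IsIncrementSolution νp νm g h) {x y : ℝ} (hxy : x < y) :
    h y - g x = -2 * diffSetIntegral νp νm h (Ioo x y) := by
  have h1 := S.increment x y hxy.le
  rw [← Ioo_union_right hxy, diffSetIntegral_union (by simp) (measurableSet_singleton y)
    ((S.integrableOn x y).mono_set Ioo_subset_Icc_self)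
    ((S.integrableOn y y).mono_set (by simp)), diffSetIntegral_singleton, S.jump y] at h1
  linarith

lemma continuousWithinAt (S : IsIncrementSolution νp νm g h) (x : ℝ) :
    ContinuousWithinAt g (Ici x) x := by
  have h1 := tendsto_diffSetIntegral_zero (fun t => measurableSet_Ioc) measurableSet_Icc
    (eventually_Ioc_subset_Icc x) (S.integrableOn x (x + 1)) (eventually_notMem_Ioc x)
  have h2 := (h1.const_mul (-2)).const_add (g x)
  simp only [mul_zero, add_zero] at h2
  refine h2.congr' ?_
  filter_upwards [self_mem_nhdsWithin] with t ht
  linarith [S.increment x t ht]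

lemma tendsto_left (S : IsIncrementSolution νp νm g h) (x : ℝ) :
    Tendsto g (𝓝[<] x) (𝓝 (h x)) := by
  have h1 := tendsto_diffSetIntegral_zero (fun t => measurableSet_Ioo) measurableSet_Icc
    (eventually_Ioo_subset_Icc x) (S.integrableOn (x - 1) x) (eventually_notMem_Ioo x)
  have h2 := (h1.const_mul 2).const_add (h x)
  simp only [mul_zero, add_zero] at h2
  refine h2.congr' ?_
  filter_upwards [self_mem_nhdsWithin] with t ht
  linarith [S.left_increment ht]

lemma leftLim_eq (S : IsIncrementSolution νp νm g h) : Function.leftLim g = h :=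
  funext fun x => leftLim_eq_of_tendsto (S.tendsto_left x)

/-- A solution normalised by `g(0-) = 1` solves the original equation. -/
lemma isCadlagSolution (S : IsIncrementSolution νp νm g h) (h0 : h 0 = 1) :
    IsCadlagSolution νp νm g := by
  refine ⟨S.continuousWithinAt, fun x => by rw [S.leftLim_eq]; exact S.tendsto_left x, ?_, ?_⟩
  · intro x hx
    rw [S.leftLim_eq]
    change g x = 1 - 2 * diffSetIntegral νp νm h (Icc 0 x)
    rw [← Icc_union_Ioc_eq_Icc le_rfl hx, diffSetIntegral_union (by simp) measurableSet_Ioc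
      (S.integrableOn 0 0) ((S.integrableOn 0 x).mono_set Ioc_subset_Icc_self), Icc_self,
      diffSetIntegral_singleton]
    have := S.increment 0 x hx
    rw [S.jump 0, h0] at this
    rw [h0]
    linarith
  · intro x hx
    rw [S.leftLim_eq]
    change g x = 1 + 2 * diffSetIntegral νp νm h (Ioo x 0)
    linarith [S.left_increment hx]

end IsIncrementSolution

/-- The integral equation gives the incremental form of the equation. -/
lemma increment_of_integral_equation {νp νm : Measure ℝ} {g h : ℝ → ℝ}
    (hint : ∀ a b, IntegrableOn h (Icc a b) (νp + νm))
    (hpos : ∀ x, 0 ≤ x → g x = 1 - 2 * diffSetIntegral νp νm h (Icc 0 x))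
    (hneg : ∀ x, x < 0 → g x = 1 + 2 * diffSetIntegral νp νm h (Ioo x 0)) {x y : ℝ} (hxy : x ≤ y) :
    g y - g x = -2 * diffSetIntegral νp νm h (Ioc x y) := by
  have hIoc := (hint x y).mono_set Ioc_subset_Icc_self
  rcases le_or_gt 0 x with hx | hx
  · rw [hpos x hx, hpos y (hx.trans hxy), ← Icc_union_Ioc_eq_Icc hx hxy,
      diffSetIntegral_union (by
        rw [Set.disjoint_left]; exact fun z hz hz' => not_lt.2 hz.2 hz'.1)
        measurableSet_Ioc (hint _ _) hIoc]
    ring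
  · rcases le_or_gt 0 y with hy | hy
    · rw [hneg x hx, hpos y hy, ← Ioo_union_Icc_eq_Ioc hx hy,
        diffSetIntegral_union (by
          rw [Set.disjoint_left]; exact fun z hz hz' => not_lt.2 hz'.1 hz.2)
          measurableSet_Icc ((hint _ _).mono_set Ioo_subset_Icc_self) (hint _ _)]
      ring
    · rw [hneg x hx, hneg y hy, ← Ioc_union_Ioo_eq_Ioo hxy hy,
        diffSetIntegral_union (by
          rw [Set.disjoint_left]; exact fun z hz hz' => not_lt.2 hz.2 hz'.1)
          measurableSet_Ioo hIoc ((hint _ _).mono_set Ioo_subset_Icc_self)]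
      ring

section Cadlag

variable {g h : ℝ → ℝ}

lemma eventually_nhds_iff_nhdsLT_nhdsGE {p : ℝ → Prop} {x : ℝ} :
    (∀ᶠ y in 𝓝 x, p y) ↔ (∀ᶠ y in 𝓝[<] x, p y) ∧ ∀ᶠ y in 𝓝[≥] x, p y := by
  rw [← nhdsLT_sup_nhdsGE, eventually_sup]

lemma exists_abs_le_of_cadlag (hr : ∀ x, ContinuousWithinAt g (Ici x) x)
    (hl : ∀ x, Tendsto g (𝓝[<] x) (𝓝 (h x))) (a b : ℝ) :
    ∃ C, ∀ y ∈ Icc a b, |g y| ≤ C := by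
  refine isCompact_Icc.induction_on (p := fun s => ∃ C, ∀ y ∈ s, |g y| ≤ C) ⟨0, by simp⟩ ?_ ?_ ?_
  · rintro s t hst ⟨C, hC⟩
    exact ⟨C, fun y hy => hC y (hst hy)⟩
  · rintro s t ⟨C, hC⟩ ⟨D, hD⟩
    refine ⟨max C D, ?_⟩
    rintro y (hy | hy)
    · exact (hC y hy).trans (le_max_left _ _)
    · exact (hD y hy).trans (le_max_right _ _)
  · intro x _
    have h1 : ∀ᶠ y in 𝓝[<] x, |g y| < |h x| + 1 :=
      (hl x).abs.eventually_lt_const (lt_add_one _)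
    have h2 : ∀ᶠ y in 𝓝[≥] x, |g y| < |g x| + 1 :=
      (hr x).tendsto.abs.eventually_lt_const (lt_add_one _)
    have h3 : ∀ᶠ y in 𝓝 x, |g y| ≤ max (|h x| + 1) (|g x| + 1) :=
      eventually_nhds_iff_nhdsLT_nhdsGE.2 ⟨h1.mono fun y hy => hy.le.trans (le_max_left _ _),
        h2.mono fun y hy => hy.le.trans (le_max_right _ _)⟩
    exact ⟨_, mem_nhdsWithin_of_mem_nhds h3, _, fun y hy => hy⟩

lemma exists_abs_leftLim_le_of_cadlag (hr : ∀ x, ContinuousWithinAt g (Ici x) x)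
    (hl : ∀ x, Tendsto g (𝓝[<] x) (𝓝 (h x))) (a b : ℝ) :
    ∃ C, ∀ y ∈ Icc a b, |h y| ≤ C := by
  obtain ⟨C, hC⟩ := exists_abs_le_of_cadlag hr hl (a - 1) b
  refine ⟨C, fun y hy => le_of_tendsto (hl y).abs ?_⟩
  filter_upwards [self_mem_nhdsWithin,
    nhdsWithin_le_nhds (Ioi_mem_nhds ((sub_one_lt a).trans_le hy.1))] with t ht ht'
  exact hC t ⟨le_of_lt ht', (le_of_lt ht).trans hy.2⟩

lemma measurable_of_tendsto_nhdsLT (hl : ∀ x, Tendsto g (𝓝[<] x) (𝓝 (h x))) : Measurable h := by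
  have hρ : ∀ x : ℝ, Tendsto (fun n : ℕ => ((⌈((n : ℝ) + 1) * x⌉ : ℝ) - 1) / ((n : ℝ) + 1))
      atTop (𝓝[<] x) := by
    intro x
    refine tendsto_nhdsWithin_iff.2 ⟨?_, Eventually.of_forall fun n => ?_⟩
    · have h1 : Tendsto (fun n : ℕ => x - 1 / ((n : ℝ) + 1)) atTop (𝓝 x) := by
        simpa using tendsto_one_div_add_atTop_nhds_zero_nat.const_sub x
      refine tendsto_of_tendsto_of_tendsto_of_le_of_le h1 tendsto_const_nhds (fun n => ?_)
        fun n => ?_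
      · have hn : (0 : ℝ) < (n : ℝ) + 1 := by positivity
        simp only
        rw [le_div_iff₀ hn, sub_mul, one_div, inv_mul_cancel₀ hn.ne']
        linarith [Int.le_ceil (((n : ℝ) + 1) * x), mul_comm x ((n : ℝ) + 1)]
      · have hn : (0 : ℝ) < (n : ℝ) + 1 := by positivity
        simp only
        rw [div_le_iff₀ hn]
        linarith [Int.ceil_lt_add_one (((n : ℝ) + 1) * x), mul_comm x ((n : ℝ) + 1)]
    · have hn : (0 : ℝ) < (n : ℝ) + 1 := by positivity
      rw [mem_Iio, div_lt_iff₀ hn]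
      linarith [Int.ceil_lt_add_one (((n : ℝ) + 1) * x), mul_comm x ((n : ℝ) + 1)]
  refine measurable_of_tendsto_metrizable (f := fun (n : ℕ) (x : ℝ) =>
    g (((⌈((n : ℝ) + 1) * x⌉ : ℝ) - 1) / ((n : ℝ) + 1))) (fun n => ?_)
    (tendsto_pi_nhds.2 fun x => (hl x).comp (hρ x))
  have h1 : Measurable fun z : ℤ => g (((z : ℝ) - 1) / ((n : ℝ) + 1)) := measurable_of_countable _
  exact h1.comp (Int.measurable_ceil.comp (measurable_const_mul _))

lemma integrableOn_Icc_leftLim_of_cadlag {μ : Measure ℝ} [IsFiniteMeasureOnCompacts μ]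
    (hr : ∀ x, ContinuousWithinAt g (Ici x) x)
    (hl : ∀ x, Tendsto g (𝓝[<] x) (𝓝 (h x))) (a b : ℝ) : IntegrableOn h (Icc a b) μ := by
  obtain ⟨C, hC⟩ := exists_abs_leftLim_le_of_cadlag hr hl a b
  exact IntegrableOn.of_bound isCompact_Icc.measure_lt_top
    (measurable_of_tendsto_nhdsLT hl).aestronglyMeasurable C
    ((ae_restrict_iff' measurableSet_Icc).2 (Eventually.of_forall hC))

end Cadlag

lemma jump_of_increment {νp νm : Measure ℝ} {g h : ℝ → ℝ}
    (hint : ∀ a b, IntegrableOn h (Icc a b) (νp + νm))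
    (hl : ∀ x, Tendsto g (𝓝[<] x) (𝓝 (h x)))
    (hinc : ∀ x y, x ≤ y → g y - g x = -2 * diffSetIntegral νp νm h (Ioc x y)) (x : ℝ) :
    g x = h x * (1 - 2 * ((νp {x}).toReal - (νm {x}).toReal)) := by
  have h1 := tendsto_diffSetIntegral_zero (fun t => measurableSet_Ioo) measurableSet_Icc
    (eventually_Ioo_subset_Icc x) (hint (x - 1) x) (eventually_notMem_Ioo x)
  have h2 := ((h1.const_mul 2).const_add (g x)).add_const
    (2 * (h x * ((νp {x}).toReal - (νm {x}).toReal)))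
  have h3 : Tendsto g (𝓝[<] x) (𝓝 (g x + 2 * 0 +
      2 * (h x * ((νp {x}).toReal - (νm {x}).toReal)))) := by
    refine h2.congr' ?_
    filter_upwards [self_mem_nhdsWithin] with t ht
    have h4 := hinc t x (le_of_lt ht)
    rw [← Ioo_union_right ht, diffSetIntegral_union (by simp) (measurableSet_singleton x)
      ((hint t x).mono_set Ioo_subset_Icc_self)
      ((hint x x).mono_set (by simp)), diffSetIntegral_singleton] at h4
    linarith
  linarith [tendsto_nhds_unique h3 (hl x)]

section

variable {νp νm : Measure ℝ} [IsFiniteMeasureOnCompacts νp] [IsFiniteMeasureOnCompacts νm]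
  {g h : ℝ → ℝ}

instance isFiniteMeasureOnCompacts_add : IsFiniteMeasureOnCompacts (νp + νm) where
  lt_top_of_isCompact K hK := by
    rw [Measure.add_apply]
    exact ENNReal.add_lt_top.2 ⟨hK.measure_lt_top, hK.measure_lt_top⟩

lemma IsCadlagSolution.isIncrementSolution (hg : IsCadlagSolution νp νm g) :
    IsIncrementSolution νp νm g (Function.leftLim g) := by
  obtain ⟨hr, hl, hpos, hneg⟩ := hg
  have hint := integrableOn_Icc_leftLim_of_cadlag (μ := νp + νm) hr hl
  have hinc := fun x y => increment_of_integral_equation (x := x) (y := y) hint hpos hneg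
  exact ⟨hint, hinc, jump_of_increment hint hl hinc⟩

lemma IsCadlagSolution.leftLim_zero (hg : IsCadlagSolution νp νm g) :
    Function.leftLim g 0 = 1 := by
  have h1 := tendsto_diffSetIntegral_zero (fun t => measurableSet_Ioo) measurableSet_Icc
    (eventually_Ioo_subset_Icc 0) (hg.isIncrementSolution.integrableOn (0 - 1) 0)
    (eventually_notMem_Ioo 0)
  have h2 := (h1.const_mul 2).const_add 1
  simp only [mul_zero, add_zero] at h2
  refine tendsto_nhds_unique (hg.2.1 0) (h2.congr' ?_)
  filter_upwards [self_mem_nhdsWithin] with t ht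
  exact (hg.2.2.2 t ht).symm

end

lemma setIntegral_abs_eq_zero_of_le {μ : Measure ℝ} {h : ℝ → ℝ} {s : Set ℝ} (hs : MeasurableSet s)
    (hint : IntegrableOn h s μ) (hfin : μ s ≠ ⊤) (hμ : μ.real s ≤ 1 / 4)
    (hb : ∀ y ∈ s, |h y| ≤ 2 * ∫ z in s, |h z| ∂μ) : ∫ z in s, |h z| ∂μ = 0 := by
  have h0 : 0 ≤ ∫ z in s, |h z| ∂μ := integral_nonneg fun _ => abs_nonneg _
  have h1 : ∫ z in s, |h z| ∂μ ≤ ∫ _ in s, (2 * ∫ z in s, |h z| ∂μ) ∂μ :=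
    setIntegral_mono_on hint.abs (integrableOn_const hfin) hs hb
  rw [setIntegral_const, smul_eq_mul] at h1
  nlinarith

lemma BoundedVariationOn.of_edist_le {E F : Type*} [PseudoEMetricSpace E] [PseudoEMetricSpace F]
    {f : ℝ → E} {V : ℝ → F} {s : Set ℝ} (hV : BoundedVariationOn V s)
    (hfV : ∀ x ∈ s, ∀ y ∈ s, x ≤ y → edist (f x) (f y) ≤ edist (V x) (V y)) :
    BoundedVariationOn f s := by
  refine ne_top_of_le_ne_top hV (iSup_mono fun p => Finset.sum_le_sum fun i _ => ?_)
  rw [edist_comm, edist_comm (V _)]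
  exact hfV _ (p.2.2.2 i) _ (p.2.2.2 (i + 1)) (p.2.2.1 i.le_succ)

namespace IsIncrementSolution

variable {νp νm : Measure ℝ} {g h : ℝ → ℝ}

lemma eq_zero_iff (S : IsIncrementSolution νp νm g h)
    (hatom : ∀ x : ℝ, (νp {x}).toReal - (νm {x}).toReal < 1 / 2) {x : ℝ} :
    g x = 0 ↔ h x = 0 := by
  have := hatom x
  rw [S.jump x, mul_eq_zero, or_iff_left (by linarith)]

lemma pos_iff (S : IsIncrementSolution νp νm g h)
    (hatom : ∀ x : ℝ, (νp {x}).toReal - (νm {x}).toReal < 1 / 2) {x : ℝ} :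
    0 < g x ↔ 0 < h x := by
  have := hatom x
  rw [S.jump x, mul_pos_iff_of_pos_right (by linarith)]

lemma boundedVariationOn_Icc (S : IsIncrementSolution νp νm g h) (a b : ℝ) :
    BoundedVariationOn g (Icc a b) := by
  rcases lt_or_ge b a with hab | hab
  · simp [Icc_eq_empty_of_lt hab, BoundedVariationOn]
  set V : ℝ → ℝ := fun x => 2 * ∫ z in Ioc a x, |h z| ∂(νp + νm) with hV
  have hinc : ∀ x ∈ Icc a b, ∀ y ∈ Icc a b, x ≤ y → |g y - g x| ≤ V y - V x := by
    intro x hx y hy hxy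
    have hint : ∀ u v, IntegrableOn (fun z => |h z|) (Ioc u v) (νp + νm) := fun u v =>
      ((S.integrableOn u v).mono_set Ioc_subset_Icc_self).abs
    simp only [hV]
    rw [S.increment x y hxy, ← Ioc_union_Ioc_eq_Ioc hx.1 hxy,
      setIntegral_union (by
        rw [Set.disjoint_left]; exact fun z hz hz' => not_lt.2 hz.2 hz'.1)
        measurableSet_Ioc (hint _ _) (hint _ _), abs_mul, abs_neg, abs_two]
    linarith [abs_diffSetIntegral_le ((S.integrableOn x y).mono_set Ioc_subset_Icc_self)]
  have hmono : MonotoneOn V (Icc a b) := fun x hx y hy hxy => by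
    linarith [hinc x hx y hy hxy, abs_nonneg (g y - g x)]
  have hV' := hmono.locallyBoundedVariationOn a b (left_mem_Icc.2 hab) (right_mem_Icc.2 hab)
  rw [inter_self] at hV'
  refine hV'.of_edist_le fun x hx y hy hxy => ?_
  rw [edist_dist, edist_dist, dist_comm, dist_comm (V x), Real.dist_eq, Real.dist_eq]
  exact ENNReal.ofReal_le_ofReal ((hinc x hx y hy hxy).trans (le_abs_self _))

lemma boundedVariationOn_inv_Icc (S : IsIncrementSolution νp νm g h)
    (hatom : ∀ x : ℝ, (νp {x}).toReal - (νm {x}).toReal < 1 / 2) (hpos : ∀ x, 0 < g x)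
    (a b : ℝ) : BoundedVariationOn (fun x => (g x)⁻¹) (Icc a b) := by
  obtain ⟨C, hC⟩ := exists_abs_le_of_cadlag (g := fun x => (g x)⁻¹) (h := fun x => (h x)⁻¹)
    (fun x => (S.continuousWithinAt x).inv₀ (hpos x).ne')
    (fun x => (S.tendsto_left x).inv₀ ((S.pos_iff hatom).1 (hpos x)).ne') a b
  have hL : LipschitzOnWith (Real.toNNReal (C * C)) (fun z : ℝ => z⁻¹) {z | 0 < z ∧ z⁻¹ ≤ C} := by
    refine LipschitzOnWith.of_dist_le_mul fun u hu v hv => ?_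
    have hu' := inv_pos.2 hu.1
    have hv' := inv_pos.2 hv.1
    rw [Real.coe_toNNReal _ (mul_self_nonneg C), Real.dist_eq, Real.dist_eq,
      inv_sub_inv hu.1.ne' hv.1.ne', abs_div, abs_sub_comm v u, div_eq_inv_mul,
      abs_of_pos (mul_pos hu.1 hv.1), mul_inv]
    exact mul_le_mul_of_nonneg_right
      (mul_le_mul hu.2 hv.2 hv'.le (hu'.le.trans hu.2)) (abs_nonneg _)
  exact hL.comp_boundedVariationOn
    (fun x hx => ⟨hpos x, (le_abs_self _).trans (hC x hx)⟩) (S.boundedVariationOn_Icc a b)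

variable [IsFiniteMeasureOnCompacts νp] [IsFiniteMeasureOnCompacts νm]

lemma eventually_nhdsGE_eq_zero (S : IsIncrementSolution νp νm g h) {x : ℝ} (hx : g x = 0) :
    ∀ᶠ t in 𝓝[≥] x, g t = 0 := by
  have h1 := tendsto_setIntegral_zero_of_eventually_notMem (h := fun _ => (1 : ℝ)) (μ := νp + νm)
    (fun t => measurableSet_Ioc) measurableSet_Icc
    (eventually_Ioc_subset_Icc x) (integrableOn_const isCompact_Icc.measure_lt_top.ne)
    (eventually_notMem_Ioc x)
  have h2 := (h1.mono_left (nhdsWithin_mono x Ioi_subset_Ici_self)).eventually_lt_const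
    (show (0 : ℝ) < 1 / 4 by norm_num)
  obtain ⟨b, hb, hxb⟩ := (h2.and self_mem_nhdsWithin).exists
  rw [setIntegral_const, smul_eq_mul, mul_one] at hb
  have hint := (S.integrableOn x b).mono_set Ioc_subset_Icc_self
  have hle : ∀ s ⊆ Ioc x b, |diffSetIntegral νp νm h s| ≤ ∫ z in Ioc x b, |h z| ∂(νp + νm) := by
    intro s hs
    refine (abs_diffSetIntegral_le (hint.mono_set hs)).trans ?_
    exact setIntegral_mono_set hint.abs (Eventually.of_forall fun _ => abs_nonneg _)
      hs.eventuallyLE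
  have hI := setIntegral_abs_eq_zero_of_le measurableSet_Ioc hint
    measure_Ioc_lt_top.ne hb.le fun y hy => by
      have h3 := S.left_increment hy.1
      rw [hx, sub_zero] at h3
      rw [h3, abs_mul, abs_neg, abs_two]
      exact mul_le_mul_of_nonneg_left
        (hle _ (Ioo_subset_Ioc_self.trans (Ioc_subset_Ioc_right hy.2))) two_pos.le
  filter_upwards [self_mem_nhdsWithin, nhdsWithin_le_nhds (Iio_mem_nhds hxb)] with t ht ht'
  have h3 := hle _ (Ioc_subset_Ioc_right (le_of_lt ht') : Ioc x t ⊆ Ioc x b)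
  rw [hI, abs_nonpos_iff] at h3
  have h4 := S.increment x t ht
  rw [h3, hx] at h4
  linarith

lemma eventually_nhdsLT_eq_zero (S : IsIncrementSolution νp νm g h) {x : ℝ} (hx : h x = 0) :
    ∀ᶠ t in 𝓝[<] x, g t = 0 := by
  have h1 := tendsto_setIntegral_zero_of_eventually_notMem (h := fun _ => (1 : ℝ)) (μ := νp + νm)
    (fun t => measurableSet_Ioo) measurableSet_Icc
    (eventually_Ioo_subset_Icc x) (integrableOn_const isCompact_Icc.measure_lt_top.ne)
    (eventually_notMem_Ioo x)
  have h2 := h1.eventually_lt_const (show (0 : ℝ) < 1 / 4 by norm_num)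
  obtain ⟨a, ha, hax⟩ := (h2.and self_mem_nhdsWithin).exists
  rw [setIntegral_const, smul_eq_mul, mul_one] at ha
  have hint := (S.integrableOn a x).mono_set Ioo_subset_Icc_self
  have hle : ∀ t ∈ Ioo a x, |g t| ≤ 2 * ∫ z in Ioo a x, |h z| ∂(νp + νm) := by
    intro t ht
    have hs : Ioo t x ⊆ Ioo a x := Ioo_subset_Ioo_left ht.1.le
    have h3 := S.left_increment ht.2
    rw [hx, zero_sub] at h3
    rw [← abs_neg, h3, abs_mul, abs_neg, abs_two]
    refine mul_le_mul_of_nonneg_left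
      ((abs_diffSetIntegral_le (hint.mono_set hs)).trans ?_) two_pos.le
    exact setIntegral_mono_set hint.abs (Eventually.of_forall fun _ => abs_nonneg _)
      hs.eventuallyLE
  have hI := setIntegral_abs_eq_zero_of_le measurableSet_Ioo hint
    measure_Ioo_lt_top.ne ha.le fun y hy => by
      refine le_of_tendsto (S.tendsto_left y).abs ?_
      filter_upwards [self_mem_nhdsWithin, nhdsWithin_le_nhds (Ioi_mem_nhds hy.1)] with t ht ht'
      exact hle t ⟨ht', lt_trans ht hy.2⟩
  filter_upwards [self_mem_nhdsWithin, nhdsWithin_le_nhds (Ioi_mem_nhds hax)] with t ht ht'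
  have h3 := hle t ⟨ht', ht⟩
  rwa [hI, mul_zero, abs_nonpos_iff] at h3

/-- A solution of the incremental equation that vanishes somewhere vanishes everywhere. -/
lemma eq_zero_of_eq_zero (S : IsIncrementSolution νp νm g h)
    (hatom : ∀ x : ℝ, (νp {x}).toReal - (νm {x}).toReal < 1 / 2) {x₀ : ℝ} (hx₀ : g x₀ = 0)
    (x : ℝ) : g x = 0 := by
  have hclopen : IsClopen {x | g x = 0} := by
    constructor
    · refine ⟨isOpen_iff_mem_nhds.2 fun x hx => ?_⟩
      refine eventually_nhds_iff_nhdsLT_nhdsGE.2 ⟨?_, ?_⟩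
      · exact (S.tendsto_left x).eventually_ne fun h0 => hx ((S.eq_zero_iff hatom).2 h0)
      · exact (S.continuousWithinAt x).tendsto.eventually_ne hx
    · refine isOpen_iff_mem_nhds.2 fun x hx => ?_
      exact eventually_nhds_iff_nhdsLT_nhdsGE.2
        ⟨S.eventually_nhdsLT_eq_zero ((S.eq_zero_iff hatom).1 hx), S.eventually_nhdsGE_eq_zero hx⟩
  have huniv := hclopen.eq_univ ⟨x₀, hx₀⟩
  exact huniv.ge (mem_univ x)

lemma pos_of_pos (S : IsIncrementSolution νp νm g h)
    (hatom : ∀ x : ℝ, (νp {x}).toReal - (νm {x}).toReal < 1 / 2) {x₀ : ℝ} (hx₀ : 0 < g x₀)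
    (x : ℝ) : 0 < g x := by
  have hne : ∀ x, g x ≠ 0 := fun x hx => hx₀.ne' (S.eq_zero_of_eq_zero hatom hx x₀)
  have hclopen : IsClopen {x | 0 < g x} := by
    constructor
    · refine ⟨isOpen_iff_mem_nhds.2 fun x hx => ?_⟩
      have hx' : g x < 0 := lt_of_le_of_ne (not_lt.1 hx) (hne x)
      have hh : h x < 0 := lt_of_le_of_ne (not_lt.1 fun h0 => hx ((S.pos_iff hatom).2 h0))
        fun h0 => hne x ((S.eq_zero_iff hatom).2 h0)
      refine eventually_nhds_iff_nhdsLT_nhdsGE.2 ⟨?_, ?_⟩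
      · exact ((S.tendsto_left x).eventually_lt_const hh).mono fun y hy => not_lt.2 hy.le
      · exact ((S.continuousWithinAt x).tendsto.eventually_lt_const hx').mono
          fun y hy => not_lt.2 hy.le
    · refine isOpen_iff_mem_nhds.2 fun x hx => ?_
      exact eventually_nhds_iff_nhdsLT_nhdsGE.2
        ⟨(S.tendsto_left x).eventually_const_lt ((S.pos_iff hatom).1 hx),
          (S.continuousWithinAt x).tendsto.eventually_const_lt hx⟩
  exact (hclopen.eq_univ ⟨x₀, hx₀⟩).ge (mem_univ x)

end IsIncrementSolution

section Volterra

open scoped ENNReal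

/-- The mass of the chains of length `n` below `x` for the relation `r`, as an iterated integral. -/
noncomputable def chainMass {α : Type*} [MeasurableSpace α] (μ : Measure α) (r : α → α → Prop) :
    ℕ → α → ℝ≥0∞
  | 0 => fun _ => 1
  | n + 1 => fun x => ∫⁻ y in {y | r y x}, chainMass μ r n y ∂μ

section ChainMass

variable {α : Type*} [MeasurableSpace α] {μ : Measure α} {r : α → α → Prop}

lemma measurableSet_lower (hr : MeasurableSet {p : α × α | r p.1 p.2}) (x : α) :
    MeasurableSet {y | r y x} :=
  measurable_prodMk_right hr

lemma measurable_setLIntegral_lower [SFinite μ] (hr : MeasurableSet {p : α × α | r p.1 p.2})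
    {f : α → ℝ≥0∞} (hf : Measurable f) : Measurable fun x => ∫⁻ y in {y | r y x}, f y ∂μ := by
  have h1 : Measurable fun x => ∫⁻ y, {p : α × α | r p.2 p.1}.indicator (fun p => f p.2) (x, y) ∂μ :=
    Measurable.lintegral_prod_right' ((hf.comp measurable_snd).indicator (measurable_swap hr))
  convert h1 using 2 with x
  rw [← lintegral_indicator (measurableSet_lower hr x)]
  rfl

lemma stronglyMeasurable_setIntegral_lower [SFinite μ]
    (hr : MeasurableSet {p : α × α | r p.1 p.2}) {f : α → ℝ} (hf : Measurable f) :
    StronglyMeasurable fun x => ∫ y in {y | r y x}, f y ∂μ := by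
  have h1 : StronglyMeasurable fun x =>
      ∫ y, {p : α × α | r p.2 p.1}.indicator (fun p => f p.2) (x, y) ∂μ :=
    StronglyMeasurable.integral_prod_right'
      ((hf.comp measurable_snd).indicator (measurable_swap hr)).stronglyMeasurable
  convert h1 using 2 with x
  rw [← integral_indicator (measurableSet_lower hr x)]
  rfl

lemma measurable_chainMass [SFinite μ] (hr : MeasurableSet {p : α × α | r p.1 p.2}) :
    ∀ n, Measurable (chainMass μ r n)
  | 0 => measurable_const
  | n + 1 => measurable_setLIntegral_lower hr (measurable_chainMass hr n)

lemma succ_mul_chainMass_le [SFinite μ] (hr : MeasurableSet {p : α × α | r p.1 p.2})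
    (htrans : ∀ x y z, r x y → r y z → r x z) (hasymm : ∀ x y, r x y → ¬ r y x) (n : ℕ) (x : α) :
    ((n : ℝ≥0∞) + 1) * chainMass μ r (n + 1) x ≤ μ {y | r y x} * chainMass μ r n x := by
  induction n generalizing x with
  | zero => simp [chainMass]
  | succ n ih =>
    have hD := measurableSet_lower hr x
    have hJ := measurable_chainMass (μ := μ) hr n
    have hup : ∀ v, MeasurableSet {u | r v u} := fun v => measurable_prodMk_left hr
    have hswap : chainMass μ r (n + 1 + 1) x =
        ∫⁻ v in {y | r y x}, μ ({u | r v u} ∩ {y | r y x}) * chainMass μ r n v ∂μ := by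
      calc chainMass μ r (n + 1 + 1) x
          = ∫⁻ u in {y | r y x}, ∫⁻ v in {y | r y x},
              {p : α × α | r p.2 p.1}.indicator (fun p => chainMass μ r n p.2) (u, v) ∂μ ∂μ := by
            refine setLIntegral_congr_fun hD fun u hu => ?_
            have hsub : {v | r v u} ∩ {y | r y x} = {v | r v u} :=
              inter_eq_left.2 fun v hv => htrans v u x hv hu
            change ∫⁻ v in {v | r v u}, chainMass μ r n v ∂μ =
              ∫⁻ v in {y | r y x}, {v | r v u}.indicator (chainMass μ r n) v ∂μ
            rw [lintegral_indicator (measurableSet_lower hr u),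
              Measure.restrict_restrict (measurableSet_lower hr u), hsub]
        _ = ∫⁻ v in {y | r y x}, ∫⁻ u in {y | r y x},
              {p : α × α | r p.2 p.1}.indicator (fun p => chainMass μ r n p.2) (u, v) ∂μ ∂μ :=
            lintegral_lintegral_swap
              ((hJ.comp measurable_snd).indicator (measurable_swap hr)).aemeasurable
        _ = _ := by
            refine setLIntegral_congr_fun hD fun v hv => ?_
            change ∫⁻ u in {y | r y x}, {u | r v u}.indicator (fun _ => chainMass μ r n v) u ∂μ = _
            rw [lintegral_indicator (hup v), Measure.restrict_restrict (hup v), lintegral_const,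
              Measure.restrict_apply_univ, mul_comm]
    calc ((n + 1 : ℕ) + 1 : ℝ≥0∞) * chainMass μ r (n + 1 + 1) x
        = ((n : ℝ≥0∞) + 1) * chainMass μ r (n + 1 + 1) x + chainMass μ r (n + 1 + 1) x := by
          push_cast; ring
      _ ≤ (∫⁻ v in {y | r y x}, μ {y | r y v} * chainMass μ r n v ∂μ) +
            ∫⁻ v in {y | r y x}, μ ({u | r v u} ∩ {y | r y x}) * chainMass μ r n v ∂μ := by
          refine add_le_add ?_ hswap.le
          change _ * (∫⁻ v in {y | r y x}, chainMass μ r (n + 1) v ∂μ) ≤ _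
          rw [← lintegral_const_mul _ (measurable_chainMass hr (n + 1))]
          exact lintegral_mono fun v => ih v
      _ = ∫⁻ v in {y | r y x}, (μ {y | r y v} * chainMass μ r n v +
            μ ({u | r v u} ∩ {y | r y x}) * chainMass μ r n v) ∂μ := by
          refine (lintegral_add_left ?_ _).symm
          refine Measurable.mul ?_ hJ
          simpa using measurable_setLIntegral_lower (μ := μ) hr (measurable_const (a := 1))
      _ ≤ ∫⁻ v in {y | r y x}, μ {y | r y x} * chainMass μ r n v ∂μ := by
          refine setLIntegral_mono' hD fun v hv => ?_
          rw [← add_mul]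
          refine mul_le_mul_left ?_ _
          rw [← measure_union _ ((hup v).inter hD)]
          · refine measure_mono (union_subset (fun u hu => htrans u v x hu hv) inter_subset_right)
          · rw [Set.disjoint_left]
            exact fun u hu hu' => hasymm u v hu hu'.1
      _ = μ {y | r y x} * chainMass μ r (n + 1) x := lintegral_const_mul _ hJ

lemma factorial_mul_chainMass_le [SFinite μ] (hr : MeasurableSet {p : α × α | r p.1 p.2})
    (htrans : ∀ x y z, r x y → r y z → r x z) (hasymm : ∀ x y, r x y → ¬ r y x) (n : ℕ) (x : α) :
    (n.factorial : ℝ≥0∞) * chainMass μ r n x ≤ μ {y | r y x} ^ n := by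
  induction n with
  | zero => simp [chainMass]
  | succ n ih =>
    calc ((n + 1).factorial : ℝ≥0∞) * chainMass μ r (n + 1) x
        = n.factorial * (((n : ℝ≥0∞) + 1) * chainMass μ r (n + 1) x) := by
          rw [Nat.factorial_succ]; push_cast; ring
      _ ≤ n.factorial * (μ {y | r y x} * chainMass μ r n x) :=
          mul_le_mul_right (succ_mul_chainMass_le hr htrans hasymm n x) _
      _ = μ {y | r y x} * (n.factorial * chainMass μ r n x) := by ring
      _ ≤ μ {y | r y x} * μ {y | r y x} ^ n := mul_le_mul_right ih _
      _ = _ := (pow_succ' _ _).symm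

lemma tsum_chainMass_ne_top [SFinite μ] (hr : MeasurableSet {p : α × α | r p.1 p.2})
    (htrans : ∀ x y z, r x y → r y z → r x z) (hasymm : ∀ x y, r x y → ¬ r y x) {x : α}
    (hx : μ {y | r y x} ≠ ∞) : ∑' n, chainMass μ r n x ≠ ∞ := by
  have hle : ∀ n, chainMass μ r n x ≤
      ENNReal.ofReal ((μ {y | r y x}).toReal ^ n / (n.factorial : ℝ)) := by
    intro n
    rw [ENNReal.ofReal_div_of_pos (by positivity), ENNReal.ofReal_pow ENNReal.toReal_nonneg,
      ENNReal.ofReal_toReal hx, ENNReal.ofReal_natCast,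
      ENNReal.le_div_iff_mul_le (Or.inl (by positivity)) (Or.inl (by simp)), mul_comm]
    exact factorial_mul_chainMass_le hr htrans hasymm n x
  refine ne_top_of_le_ne_top ?_ (ENNReal.tsum_le_tsum hle)
  exact (Real.summable_pow_div_factorial _).tsum_ofReal_ne_top

end ChainMass

/-- The Picard iterates for a Volterra equation with respect to the relation `r`. -/
noncomputable def picardIterate (νp νm : Measure ℝ) (r : ℝ → ℝ → Prop) (w : ℝ → ℝ) : ℕ → ℝ → ℝ
  | 0 => fun _ => 1
  | n + 1 => fun x => diffSetIntegral νp νm (fun y => w y * picardIterate νp νm r w n y) {y | r y x}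

variable {νp νm : Measure ℝ} {r : ℝ → ℝ → Prop} {w : ℝ → ℝ}

lemma measurable_picardIterate [SFinite νp] [SFinite νm]
    (hr : MeasurableSet {p : ℝ × ℝ | r p.1 p.2}) (hw : Measurable w) :
    ∀ n, Measurable (picardIterate νp νm r w n)
  | 0 => measurable_const
  | n + 1 =>
    have hm := hw.mul (measurable_picardIterate hr hw n)
    (stronglyMeasurable_setIntegral_lower hr hm).measurable.sub
      (stronglyMeasurable_setIntegral_lower hr hm).measurable

lemma setLIntegral_mul_enorm_picardIterate_le [SFinite νp] [SFinite νm]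
    (hr : MeasurableSet {p : ℝ × ℝ | r p.1 p.2}) (hw : Measurable w) (n : ℕ)
    (hle : ∀ y, ‖picardIterate νp νm r w n y‖ₑ ≤
      chainMass ((νp + νm).withDensity fun y => ‖w y‖ₑ) r n y) (x : ℝ) :
    ∫⁻ y in {y | r y x}, ‖w y * picardIterate νp νm r w n y‖ₑ ∂(νp + νm) ≤
      chainMass ((νp + νm).withDensity fun y => ‖w y‖ₑ) r (n + 1) x := by
  simp only [chainMass]
  rw [setLIntegral_withDensity_eq_setLIntegral_mul _ hw.enorm (measurable_chainMass hr n)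
    (measurableSet_lower hr x)]
  refine lintegral_mono fun y => ?_
  rw [enorm_mul]
  exact mul_le_mul_right (hle y) _

lemma enorm_picardIterate_le [SFinite νp] [SFinite νm]
    (hr : MeasurableSet {p : ℝ × ℝ | r p.1 p.2}) (hw : Measurable w) (n : ℕ) (x : ℝ) :
    ‖picardIterate νp νm r w n x‖ₑ ≤
      chainMass ((νp + νm).withDensity fun y => ‖w y‖ₑ) r n x := by
  induction n generalizing x with
  | zero => simp [picardIterate, chainMass]
  | succ n ih =>
    refine le_trans ?_ (setLIntegral_mul_enorm_picardIterate_le hr hw n ih x)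
    rw [Measure.restrict_add, lintegral_add_measure]
    refine (enorm_sub_le (a := ∫ y in {y | r y x}, w y * picardIterate νp νm r w n y ∂νp)).trans ?_
    exact add_le_add (enorm_integral_le_lintegral_enorm _) (enorm_integral_le_lintegral_enorm _)

/-- Solvability of the Volterra equation `φ(x) = 1 + ∫_{r y x} w(y) φ(y) (νp - νm)(dy)` for a strict
partial order `r`. -/
lemma exists_volterra_solution [SFinite νp] [SFinite νm]
    (hr : MeasurableSet {p : ℝ × ℝ | r p.1 p.2})
    (htrans : ∀ x y z, r x y → r y z → r x z) (hasymm : ∀ x y, r x y → ¬ r y x)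
    (hw : Measurable w) (hint : ∀ x, IntegrableOn w {y | r y x} (νp + νm)) :
    ∃ φ : ℝ → ℝ, (∀ x, IntegrableOn (fun y => w y * φ y) {y | r y x} (νp + νm)) ∧
      ∀ x, φ x = 1 + diffSetIntegral νp νm (fun y => w y * φ y) {y | r y x} := by
  set J := chainMass ((νp + νm).withDensity fun y => ‖w y‖ₑ) r with hJ
  set f := picardIterate νp νm r w with hf
  have hfm : ∀ n, Measurable (f n) := measurable_picardIterate hr hw
  have hfJ : ∀ n x, ‖f n x‖ₑ ≤ J n x := enorm_picardIterate_le hr hw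
  have hJtop : ∀ x, ∑' n, J n x ≠ ∞ := fun x => by
    refine tsum_chainMass_ne_top hr htrans hasymm ?_
    rw [withDensity_apply _ (measurableSet_lower hr x)]
    exact (hint x).2.ne
  have hwJ : ∀ n x, ∫⁻ y in {y | r y x}, ‖w y * f n y‖ₑ ∂(νp + νm) ≤ J (n + 1) x :=
    fun n x => setLIntegral_mul_enorm_picardIterate_le hr hw n (hfJ n) x
  have hsum : ∀ x, ∑' n, ∫⁻ y in {y | r y x}, ‖w y * f n y‖ₑ ∂(νp + νm) ≠ ∞ := fun x =>
    ne_top_of_le_ne_top (hJtop x) ((ENNReal.tsum_le_tsum fun n => hwJ n x).trans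
      (ENNReal.tsum_comp_le_tsum_of_injective (add_left_injective 1) fun n => J n x))
  have hsumm : ∀ x, Summable fun n => f n x := fun x => by
    refine Summable.of_enorm (ne_top_of_le_ne_top (hJtop x) (ENNReal.tsum_le_tsum fun n => hfJ n x))
  have hmeas : Measurable fun y => w y * ∑' n, f n y :=
    hw.mul (measurable_of_tendsto_metrizable
      (fun n => Finset.measurable_sum (Finset.range n) fun i _ => hfm i)
      (tendsto_pi_nhds.2 fun x => by simpa using (hsumm x).hasSum.tendsto_sum_nat))
  refine ⟨fun x => ∑' n, f n x, fun x => ⟨hmeas.aestronglyMeasurable, ?_⟩, fun x => ?_⟩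
  · refine lt_of_le_of_lt ?_ (hsum x).lt_top
    have hm : ∀ n, Measurable fun y => ‖w y * f n y‖ₑ := fun n => (hw.mul (hfm n)).enorm
    rw [← lintegral_tsum fun n => (hm n).aemeasurable]
    refine lintegral_mono fun y => ?_
    simp only
    rw [← tsum_mul_left]
    exact enorm_tsum_le_tsum_enorm
  · have hswap : ∀ ν : Measure ℝ, ν ≤ νp + νm →
        HasSum (fun n => ∫ y in {y | r y x}, w y * f n y ∂ν)
          (∫ y in {y | r y x}, w y * ∑' n, f n y ∂ν) := by
      intro ν hν
      have htop : ∑' n, ∫⁻ y in {y | r y x}, ‖w y * f n y‖ₑ ∂ν ≠ ∞ :=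
        ne_top_of_le_ne_top (hsum x) (ENNReal.tsum_le_tsum fun n =>
          lintegral_mono' (Measure.restrict_mono le_rfl hν) le_rfl)
      have hS : Summable fun n => ∫ y in {y | r y x}, w y * f n y ∂ν :=
        Summable.of_enorm (ne_top_of_le_ne_top htop
          (ENNReal.tsum_le_tsum fun n => enorm_integral_le_lintegral_enorm _))
      have heq := integral_tsum (μ := ν.restrict {y | r y x})
        (fun n => (hw.mul (hfm n)).aestronglyMeasurable) htop
      simp only [Pi.mul_apply, tsum_mul_left] at heq
      rw [heq]
      exact hS.hasSum
    refine (hsumm x).tsum_eq_zero_add.trans ?_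
    exact congrArg (1 + ·) ((hswap νp (Measure.le_add_right le_rfl)).sub
      (hswap νm (Measure.le_add_left le_rfl))).tsum_eq

end Volterra

section Existence

variable {νp νm : Measure ℝ} [IsFiniteMeasureOnCompacts νp]

lemma measurable_measure_singleton (μ : Measure ℝ) [SFinite μ] : Measurable fun x => μ {x} := by
  have h1 := measurable_measure_prodMk_left (ν := μ) (measurableSet_diagonal (α := ℝ))
  convert h1 using 3 with x
  ext y
  simp [eq_comm]

lemma exists_inv_jump_le (hatom : ∀ x : ℝ, (νp {x}).toReal - (νm {x}).toReal < 1 / 2) (a b : ℝ) :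
    ∃ C, ∀ y ∈ Icc a b, |(1 - 2 * ((νp {y}).toReal - (νm {y}).toReal))⁻¹| ≤ C := by
  have hpos : ∀ y, 0 < 1 - 2 * ((νp {y}).toReal - (νm {y}).toReal) := fun y => by
    linarith [hatom y]
  have hfin : {y | ENNReal.ofReal (1 / 4) ≤ νp.restrict (Icc a b) {y}}.Finite := by
    refine Measure.finite_const_le_meas_of_disjoint_iUnion _ (by simp)
      (fun y => measurableSet_singleton y)
      (fun x y hxy => by simpa [Function.onFun] using hxy) ?_
    refine ne_top_of_le_ne_top ?_ (measure_mono (subset_univ _))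
    rw [Measure.restrict_apply_univ]
    exact measure_Icc_lt_top.ne
  obtain ⟨C, hC⟩ := (hfin.image fun y =>
    (1 - 2 * ((νp {y}).toReal - (νm {y}).toReal))⁻¹).bddAbove
  refine ⟨max C 2, fun y hy => ?_⟩
  rw [abs_of_pos (inv_pos.2 (hpos y))]
  by_cases hyS : ENNReal.ofReal (1 / 4) ≤ νp.restrict (Icc a b) {y}
  · exact (hC ⟨y, hyS, rfl⟩).trans (le_max_left _ _)
  · refine le_trans ?_ (le_max_right _ _)
    rw [Measure.restrict_apply (measurableSet_singleton y),
      inter_eq_left.2 (singleton_subset_iff.2 hy), not_le] at hyS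
    have h1 : (νp {y}).toReal < 1 / 4 :=
      (ENNReal.lt_ofReal_iff_toReal_lt isCompact_singleton.measure_lt_top.ne).1 hyS
    have h2 : 0 ≤ (νm {y}).toReal := ENNReal.toReal_nonneg
    rw [inv_le_comm₀ (hpos y) two_pos]
    linarith

variable [IsFiniteMeasureOnCompacts νm]

/-- The order in which the integral equation is solved: away from the origin, in both directions. -/
def OutwardLT (y x : ℝ) : Prop := (0 ≤ y ∧ y < x) ∨ (x < y ∧ y < 0)

lemma measurableSet_outwardLT : MeasurableSet {p : ℝ × ℝ | OutwardLT p.1 p.2} :=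
  ((measurableSet_le measurable_const measurable_fst).inter
    (measurableSet_lt measurable_fst measurable_snd)).union
    ((measurableSet_lt measurable_snd measurable_fst).inter
      (measurableSet_lt measurable_fst measurable_const))

lemma setOf_outwardLT_of_nonneg {x : ℝ} (hx : 0 ≤ x) : {y | OutwardLT y x} = Ico 0 x := by
  ext y
  simp only [OutwardLT, mem_ofPred_eq, mem_Ico]
  exact or_iff_left fun h => by linarith [h.1, h.2]

lemma setOf_outwardLT_of_neg {x : ℝ} (hx : x < 0) : {y | OutwardLT y x} = Ioo x 0 := by
  ext y
  simp only [OutwardLT, mem_ofPred_eq, mem_Ioo]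
  exact or_iff_right fun h => by linarith [h.1, h.2]

lemma exists_isIncrementSolution
    (hatom : ∀ x : ℝ, (νp {x}).toReal - (νm {x}).toReal < 1 / 2) :
    ∃ g h : ℝ → ℝ, IsIncrementSolution νp νm g h ∧ h 0 = 1 := by
  set m : ℝ → ℝ := fun x => 1 - 2 * ((νp {x}).toReal - (νm {x}).toReal) with hm
  have hm0 : ∀ x, m x ≠ 0 := fun x => by
    have := hatom x
    simp only [hm]
    linarith
  have hmm : Measurable m :=
    (((measurable_measure_singleton νp).ennreal_toReal.sub
      (measurable_measure_singleton νm).ennreal_toReal).const_mul 2).const_sub 1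
  set w : ℝ → ℝ := fun x => if 0 ≤ x then -2 else 2 * (m x)⁻¹ with hw
  have hwm : Measurable w := Measurable.ite measurableSet_Ici measurable_const (hmm.inv.const_mul 2)
  have hwint : ∀ a b, IntegrableOn w (Icc a b) (νp + νm) := fun a b => by
    obtain ⟨C, hC⟩ := exists_inv_jump_le hatom a b
    refine IntegrableOn.of_bound measure_Icc_lt_top hwm.aestronglyMeasurable (max 2 (2 * C))
      ((ae_restrict_iff' measurableSet_Icc).2 (Eventually.of_forall fun y hy => ?_))
    simp only [hw]
    split_ifs
    · simp
    · rw [norm_mul, Real.norm_eq_abs, Real.norm_eq_abs, abs_two]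
      exact (mul_le_mul_of_nonneg_left (hC y hy) two_pos.le).trans (le_max_right _ _)
  obtain ⟨φ, hφint, hφ⟩ := exists_volterra_solution (νp := νp) (νm := νm) (r := OutwardLT) (w := w)
    measurableSet_outwardLT
    (by
      rintro x y z (h1 | h1) (h2 | h2)
      · exact Or.inl ⟨h1.1, h1.2.trans h2.2⟩
      · linarith [h1.1, h1.2, h2.1, h2.2]
      · linarith [h1.1, h1.2, h2.1, h2.2]
      · exact Or.inr ⟨h2.1.trans h1.1, h1.2⟩)
    (by
      rintro x y (h1 | h1) (h2 | h2) <;> linarith [h1.1, h1.2, h2.1, h2.2])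
    hwm
    (fun x => by
      rcases le_or_gt 0 x with hx | hx
      · rw [setOf_outwardLT_of_nonneg hx]
        exact (hwint 0 x).mono_set Ico_subset_Icc_self
      · rw [setOf_outwardLT_of_neg hx]
        exact (hwint x 0).mono_set Ioo_subset_Icc_self)
  set h : ℝ → ℝ := fun x => if 0 ≤ x then φ x else φ x * (m x)⁻¹ with hh
  have hhpos : ∀ x, 0 ≤ x → h x = φ x := fun x hx => if_pos hx
  have hhneg : ∀ x, x < 0 → h x = φ x * (m x)⁻¹ := fun x hx => if_neg (not_le.2 hx)
  have hwpos : ∀ x, ∀ y ∈ Ico 0 x, w y * φ y = -2 * h y := fun x y hy => by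
    rw [hhpos y hy.1]
    simp [hw, hy.1]
  have hwneg : ∀ x, ∀ y ∈ Ioo x 0, w y * φ y = 2 * h y := fun x y hy => by
    rw [hhneg y hy.2]
    simp only [hw, if_neg (not_le.2 hy.2)]
    ring
  have hintpos : ∀ x, 0 ≤ x → IntegrableOn h (Ico 0 x) (νp + νm) := fun x hx => by
    have h1 := hφint x
    rw [setOf_outwardLT_of_nonneg hx, integrableOn_congr_fun (hwpos x) measurableSet_Ico] at h1
    exact (integrable_const_mul_iff (by norm_num) _).1 h1
  have hintneg : ∀ x, x < 0 → IntegrableOn h (Ioo x 0) (νp + νm) := fun x hx => by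
    have h1 := hφint x
    rw [setOf_outwardLT_of_neg hx, integrableOn_congr_fun (hwneg x) measurableSet_Ioo] at h1
    exact (integrable_const_mul_iff (by norm_num) _).1 h1
  have hint : ∀ a b, IntegrableOn h (Icc a b) (νp + νm) := fun a b => by
    refine ((hintpos (|b| + 1) (by positivity)).union
      (hintneg (-|a| - 1) (by linarith [abs_nonneg a]))).mono_set fun y hy => ?_
    rcases le_or_gt 0 y with hy0 | hy0
    · exact Or.inl ⟨hy0, by linarith [hy.2, le_abs_self b]⟩
    · exact Or.inr ⟨by linarith [hy.1, neg_abs_le a], hy0⟩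
  have hφpos : ∀ x, 0 ≤ x → φ x = 1 - 2 * diffSetIntegral νp νm h (Ico 0 x) := fun x hx => by
    rw [hφ x, setOf_outwardLT_of_nonneg hx]
    simp only [diffSetIntegral]
    rw [setIntegral_congr_fun measurableSet_Ico (hwpos x),
      setIntegral_congr_fun measurableSet_Ico (hwpos x), integral_const_mul, integral_const_mul]
    ring
  have hφneg : ∀ x, x < 0 → φ x = 1 + 2 * diffSetIntegral νp νm h (Ioo x 0) := fun x hx => by
    rw [hφ x, setOf_outwardLT_of_neg hx]
    simp only [diffSetIntegral]
    rw [setIntegral_congr_fun measurableSet_Ioo (hwneg x),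
      setIntegral_congr_fun measurableSet_Ioo (hwneg x), integral_const_mul, integral_const_mul]
    ring
  refine ⟨fun x => h x * m x, h, ⟨hint, fun x y hxy => ?_, fun x => rfl⟩, ?_⟩
  · refine increment_of_integral_equation (g := fun x => h x * m x) hint (fun x hx => ?_)
      (fun x hx => ?_) hxy
    · have h1 := hφpos x hx
      rw [← Ico_union_right hx, diffSetIntegral_union (by simp) (measurableSet_singleton x)
        (hintpos x hx) ((hint x x).mono_set (by simp)), diffSetIntegral_singleton]
      rw [← hhpos x hx] at h1
      simp only [hm]
      linarith
    · rw [hhneg x hx, mul_assoc, inv_mul_cancel₀ (hm0 x), mul_one]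
      exact hφneg x hx
  · rw [hhpos 0 le_rfl, hφpos 0 le_rfl]
    simp [diffSetIntegral]

end Existence

end

/-- Let `ν = νp - νm` be a locally finite signed measure on `ℝ` with
`ν({x}) < 1/2` for all `x`.  Then the integral equation has a unique càdlàg
solution `g_ν`; moreover any such solution is strictly positive, locally of
bounded variation, and its reciprocal is locally of bounded variation. -/
theorem exists_unique_cadlag_solution
    (νp νm : Measure ℝ)
    [IsFiniteMeasureOnCompacts νp] [IsFiniteMeasureOnCompacts νm]
    (hatom : ∀ x : ℝ, (νp {x}).toReal - (νm {x}).toReal < 1 / 2) :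
    (∃! g : ℝ → ℝ, IsCadlagSolution νp νm g) ∧
    (∀ g : ℝ → ℝ, IsCadlagSolution νp νm g →
      (∀ x, 0 < g x) ∧ LocallyBoundedVariationOn g Set.univ ∧
        LocallyBoundedVariationOn (fun x => (g x)⁻¹) Set.univ) := by
  have hinc : ∀ g, IsCadlagSolution νp νm g →
      IsIncrementSolution νp νm g (Function.leftLim g) := fun g hg => hg.isIncrementSolution
  refine ⟨?_, fun g hg => ?_⟩
  · obtain ⟨g, h, S, h0⟩ := exists_isIncrementSolution hatom
    refine ⟨g, S.isCadlagSolution h0, fun g' hg' => ?_⟩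
    have D := (hinc g' hg').sub S
    have hD0 := (D.eq_zero_iff hatom (x := 0)).2 (by rw [hg'.leftLim_zero, h0, sub_self])
    exact funext fun x => sub_eq_zero.1 (D.eq_zero_of_eq_zero hatom hD0 x)
  · have S := hinc g hg
    have hpos := S.pos_of_pos hatom
      ((S.pos_iff hatom (x := 0)).2 (by rw [hg.leftLim_zero]; exact one_pos))
    refine ⟨hpos, fun a b _ _ => ?_, fun a b _ _ => ?_⟩
    · rw [Set.univ_inter]
      exact S.boundedVariationOn_Icc a b
    · rw [Set.univ_inter]
      exact S.boundedVariationOn_inv_Icc hatom hpos a b
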